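/- arXiv:2501.03890 — 3 statements merged into one kernel-verified Lean document; each statement's English description precedes it below -/
import Mathlib

section
/- Enriched Tarski Fixed Point Theorem: Let C be a weighted lattice (a Q-category admitting all weighted meets and all weighted joins) and L : C → C a Q-functor. Then for every p, q ∈ Q, the full subcategories of q-suffix points S_q(L) = {x | q ≤ hom_C(x, L(x))}, of p-prefix points P_p(L) = {x | p ≤ hom_C(L(x), x)}, and of (p,q)-stable points F_{p,q}(L) = P_p(L) ∩ S_q(L) each admit all weighted meets and all weighted joins (with homs inherited from C); in particular each of these subcategories is nonempty. -/
/- `Q` is a commutative unital quantale: `[CommMonoid Q] [CompleteLattice Q] [IsQuantale Q]`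
(Mathlib's `IsQuantale` says multiplication distributes over arbitrary suprema).
Semicartesianness (`∀ p q, p * q ≤ p ⊓ q`) is taken as an explicit hypothesis where needed. -/

universe u v w

/-- The internal hom `[p,q] := ⨆ {r | p·r ≤ q}` of a quantale. -/
def qhom {Q : Type v} [CompleteLattice Q] [Mul Q] (p q : Q) : Q := sSup {r | p * r ≤ q}

section QCat

variable {Q : Type v} [CompleteLattice Q] [CommMonoid Q] {A : Type u}

/-- A `Q`-category structure on `A` given by a `Q`-valued hom. -/
structure IsQCategory (hom : A → A → Q) : Prop where
  hom_self : ∀ x, hom x x = 1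
  comp : ∀ x y z, hom x y * hom y z ≤ hom x z

/-- `m` is the meet of `S` weighted by `W`. -/
def IsWeightedMeet (hom : A → A → Q) {ι : Type w} (S : ι → A) (W : ι → Q) (m : A) : Prop :=
  ∀ x, hom x m = ⨅ c, qhom (W c) (hom x (S c))

/-- `j` is the join of `S` weighted by `W`. -/
def IsWeightedJoin (hom : A → A → Q) {ι : Type w} (S : ι → A) (W : ι → Q) (j : A) : Prop :=
  ∀ x, hom j x = ⨅ c, qhom (W c) (hom (S c) x)

/-- The `Q`-category has all weighted meets. -/
def HasAllWeightedMeets (hom : A → A → Q) : Prop :=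
  ∀ (ι : Type u) (S : ι → A) (W : ι → Q), ∃ m, IsWeightedMeet hom S W m

/-- The `Q`-category has all weighted joins. -/
def HasAllWeightedJoins (hom : A → A → Q) : Prop :=
  ∀ (ι : Type u) (S : ι → A) (W : ι → Q), ∃ j, IsWeightedJoin hom S W j

end QCat

/-- The full subcategory of `C` on `P` admits all weighted meets: every diagram valued in `P`
has a weighted meet lying in `P`, with the universal property relative to all objects of `P`. -/
def HasWeightedMeetsOn {Q : Type v} [CompleteLattice Q] [CommMonoid Q] {A : Type u}
    (hom : A → A → Q) (P : Set A) : Prop :=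
  ∀ (ι : Type u) (S : ι → A), (∀ c, S c ∈ P) → ∀ W : ι → Q,
    ∃ m ∈ P, ∀ x ∈ P, hom x m = ⨅ c, qhom (W c) (hom x (S c))

/-- The full subcategory of `C` on `P` admits all weighted joins. -/
def HasWeightedJoinsOn {Q : Type v} [CompleteLattice Q] [CommMonoid Q] {A : Type u}
    (hom : A → A → Q) (P : Set A) : Prop :=
  ∀ (ι : Type u) (S : ι → A), (∀ c, S c ∈ P) → ∀ W : ι → Q,
    ∃ j ∈ P, ∀ x ∈ P, hom j x = ⨅ c, qhom (W c) (hom (S c) x)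

theorem le_qhom_iff {Q : Type v} [CompleteLattice Q] [CommMonoid Q] [IsQuantale Q] {a b r : Q} :
    r ≤ qhom a b ↔ a * r ≤ b := by
  refine ⟨fun h => ?_, fun h => le_sSup h⟩
  calc a * r ≤ a * sSup {r | a * r ≤ b} := mul_le_mul_right h a
    _ ≤ b := by
      rw [IsQuantale.mul_sSup_distrib]
      exact iSup₂_le fun _ h => h

section WeightedLimits

variable {Q : Type v} [CompleteLattice Q] [CommMonoid Q] {A : Type u} {hom : A → A → Q}
  {P : Set A}

theorem IsQCategory.flip (hC : IsQCategory hom) : IsQCategory (flip hom) where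
  hom_self := hC.hom_self
  comp x y z := (mul_comm _ _).trans_le (hC.comp z y x)

theorem HasWeightedJoinsOn.nonempty (h : HasWeightedJoinsOn hom P) : P.Nonempty := by
  obtain ⟨j, hj, -⟩ := h PEmpty PEmpty.elim (fun c => c.elim) PEmpty.elim
  exact ⟨j, hj⟩

variable [IsQuantale Q]

/-- A weighted meet is the join of all objects, weighted by their degree of being a lower bound. -/
theorem HasWeightedJoinsOn.hasWeightedMeetsOn (hC : IsQCategory hom)
    (h : HasWeightedJoinsOn hom P) : HasWeightedMeetsOn hom P := by
  intro ι S hS W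
  obtain ⟨m, hm, hm'⟩ := h P (fun x => x) (fun x => x.2)
    (fun x => ⨅ c, qhom (W c) (hom x (S c)))
  refine ⟨m, hm, fun x hx => le_antisymm (le_iInf fun c => le_qhom_iff.2 ?_) ?_⟩
  · have hW : W c ≤ hom m (S c) := by
      rw [hm' _ (hS c)]
      refine le_iInf fun y => le_qhom_iff.2 ?_
      rw [mul_comm]
      exact le_qhom_iff.1 (iInf_le _ c)
    calc W c * hom x m ≤ hom m (S c) * hom x m := mul_le_mul_left hW _
      _ = hom x m * hom m (S c) := mul_comm _ _
      _ ≤ hom x (S c) := hC.comp _ _ _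
  · have h1 : (1 : Q) ≤ _ := ((hC.hom_self m).symm.trans (hm' m hm)).le
    simpa using le_qhom_iff.1 (h1.trans (iInf_le _ ⟨x, hx⟩))

/-- Suffix points of an endofunctor of `P` are closed under weighted joins. -/
theorem HasWeightedJoinsOn.inter_suffix (hC : IsQCategory hom) (h : HasWeightedJoinsOn hom P)
    {L : A → A} (hL : ∀ x y, hom x y ≤ hom (L x) (L y)) (hLP : ∀ x ∈ P, L x ∈ P) (q : Q) :
    HasWeightedJoinsOn hom (P ∩ {x | q ≤ hom x (L x)}) := by
  intro ι S hS W
  obtain ⟨j, hj, hj'⟩ := h ι S (fun c => (hS c).1) W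
  refine ⟨j, ⟨hj, ?_⟩, fun x hx => hj' x hx.1⟩
  rw [Set.mem_ofPred_eq, hj' _ (hLP j hj)]
  refine le_iInf fun c => le_qhom_iff.2 ?_
  have h1 : (1 : Q) ≤ _ := ((hC.hom_self j).symm.trans (hj' j hj)).le
  have hW : W c ≤ hom (S c) j := by
    simpa using le_qhom_iff.1 (h1.trans (iInf_le _ c))
  calc W c * q = q * W c := mul_comm _ _
    _ ≤ hom (S c) (L (S c)) * hom (L (S c)) (L j) := mul_le_mul' (hS c).2 (hW.trans (hL _ _))
    _ ≤ hom (S c) (L j) := hC.comp _ _ _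

end WeightedLimits

/-- **Enriched Tarski Fixed Point Theorem.** For a `Q`-endofunctor `L` on a
weighted lattice `C`, the subcategories of `q`-suffix points, `p`-prefix points, and
`(p,q)`-stable points admit all weighted meets and joins, and in particular are nonempty. -/
theorem enriched_tarski_fixed_point
    {Q : Type v} [CompleteLattice Q] [CommMonoid Q] [IsQuantale Q]
    (hsc : ∀ p q : Q, p * q ≤ p ⊓ q)
    {A : Type u} {hom : A → A → Q} (hC : IsQCategory hom)
    (hMeets : HasWeightedMeetsOn hom Set.univ)
    (hJoins : HasWeightedJoinsOn hom Set.univ)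
    (L : A → A) (hL : ∀ x y, hom x y ≤ hom (L x) (L y)) (p q : Q) :
    (HasWeightedMeetsOn hom {x | q ≤ hom x (L x)} ∧
      HasWeightedJoinsOn hom {x | q ≤ hom x (L x)} ∧
      {x | q ≤ hom x (L x)}.Nonempty) ∧
    (HasWeightedMeetsOn hom {x | p ≤ hom (L x) x} ∧
      HasWeightedJoinsOn hom {x | p ≤ hom (L x) x} ∧
      {x | p ≤ hom (L x) x}.Nonempty) ∧
    (HasWeightedMeetsOn hom ({x | p ≤ hom (L x) x} ∩ {x | q ≤ hom x (L x)}) ∧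
      HasWeightedJoinsOn hom ({x | p ≤ hom (L x) x} ∩ {x | q ≤ hom x (L x)}) ∧
      ({x | p ≤ hom (L x) x} ∩ {x | q ≤ hom x (L x)}).Nonempty) := by
  have hS := hJoins.inter_suffix hC hL (fun _ _ => trivial) q
  have hP : HasWeightedJoinsOn (flip hom) (Set.univ ∩ {x | p ≤ hom (L x) x}) :=
    HasWeightedJoinsOn.inter_suffix hC.flip hMeets (fun x y => hL y x) (fun _ _ => trivial) p
  rw [Set.univ_inter] at hS hP
  have hP' : HasWeightedJoinsOn hom {x | p ≤ hom (L x) x} :=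
    hP.hasWeightedMeetsOn hC.flip
  have hF := hP'.inter_suffix hC hL (fun x hx => le_trans hx (hL (L x) x)) q
  exact ⟨⟨hS.hasWeightedMeetsOn hC, hS, hS.nonempty⟩, ⟨hP, hP', hP'.nonempty⟩,
    hF.hasWeightedMeetsOn hC, hF, hF.nonempty⟩
end

section
/- Let L_W be an ε-fuzzy Lawvere Laplacian and q ∈ Q. If x ∈ C⁰F satisfies W(v,w)·q ≤ hom_{Fe}(F_{v◁e} x_v, F_{w◁e} x_w) for every edge e and every ordered pair of its endpoints v, w, then ε·q ≤ hom_{C⁰F}(x, L_W x), i.e. x is an (ε·q)-suffix point of L_W. -/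
/- `Q` is a commutative unital quantale: `[CommMonoid Q] [CompleteLattice Q] [IsQuantale Q]`
(Mathlib's `IsQuantale` says multiplication distributes over arbitrary suprema).
Semicartesianness (`∀ p q, p * q ≤ p ⊓ q`) is taken as an explicit hypothesis where needed. -/

universe u v w

section Lap

variable (Q : Type v) [CompleteLattice Q] [CommMonoid Q]

/-- A network sheaf/cosheaf pair on a finite simple undirected graph `G = (V,E)`:
weighted-lattice stalks `Fv`, `Fe` over vertices and edges, restriction `Q`-functors
`F_{v◁e} : Fv → Fe` and extension `Q`-functors `F̄_{e▷v} : Fe → Fv` for each incidence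
`v ◁ e` (i.e. `v ∈ ∂e`). -/
structure LapSetup where
  /-- vertices -/
  V : Type u
  /-- edges -/
  E : Type u
  finV : Finite V
  finE : Finite E
  /-- `incid e v` means `v ◁ e`, i.e. `v ∈ ∂e` -/
  incid : E → V → Prop
  /-- every edge has exactly two distinct endpoints -/
  two_ends : ∀ e : E, ∃ v w : V, v ≠ w ∧ ∀ u, incid e u ↔ (u = v ∨ u = w)
  /-- the graph is simple: an edge is determined by its endpoints -/
  simple : ∀ e e' : E, (∀ v, incid e v ↔ incid e' v) → e = e'
  /-- vertex stalks -/
  Fv : V → Type u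
  /-- edge stalks -/
  Fe : E → Type u
  homV : ∀ v, Fv v → Fv v → Q
  homE : ∀ e, Fe e → Fe e → Q
  catV : ∀ v, IsQCategory (homV v)
  catE : ∀ e, IsQCategory (homE e)
  meetsV : ∀ v, HasAllWeightedMeets (homV v)
  joinsV : ∀ v, HasAllWeightedJoins (homV v)
  meetsE : ∀ e, HasAllWeightedMeets (homE e)
  joinsE : ∀ e, HasAllWeightedJoins (homE e)
  /-- restriction `F_{v◁e} : Fv → Fe` -/
  res : ∀ {e v}, incid e v → Fv v → Fe e
  /-- extension `F̄_{e▷v} : Fe → Fv` -/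
  ext : ∀ {e v}, incid e v → Fe e → Fv v
  res_functor : ∀ {e v} (h : incid e v) (a b : Fv v), homV v a b ≤ homE e (res h a) (res h b)
  ext_functor : ∀ {e v} (h : incid e v) (a b : Fe e), homE e a b ≤ homV v (ext h a) (ext h b)

variable {Q}

/-- 0-cochains `C⁰F = ∏_v Fv`. -/
abbrev Cochain (D : LapSetup Q) : Type u := ∀ v : D.V, D.Fv v

/-- The hom of the product `Q`-category `C⁰F`. -/
def C0hom (D : LapSetup Q) (x y : Cochain D) : Q := ⨅ v, D.homV v (x v) (y v)

/-- The index of the neighborhood family at `v`: pairs `(e, w)` with `v ◁ e ▷ w` and `w ≠ v`. -/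
def NbIdx (D : LapSetup Q) (v : D.V) : Type u :=
  {p : D.E × D.V // D.incid p.1 v ∧ D.incid p.1 p.2 ∧ p.2 ≠ v}

/-- `L` is a Lawvere Laplacian for `D` weighted by `W`: for every cochain `x` and vertex `v`,
`(L x)_v` is the meet of the family `F̄_{e▷v} (F_{w◁e} x_w)` (over `w ∈ N_v`, `∂e = {v,w}`)
weighted by `W(v,-)`. -/
def IsLawvereLaplacian (D : LapSetup Q) (W : D.V → D.V → Q)
    (L : Cochain D → Cochain D) : Prop :=
  ∀ (x : Cochain D) (v : D.V),
    IsWeightedMeet (D.homV v)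
      (fun p : NbIdx D v => D.ext p.2.1 (D.res p.2.2.1 (x p.1.2)))
      (fun p => W v p.1.2) (L x v)

/-- The Laplacian data is `ε`-fuzzy: each restriction/extension pair `F_{v◁e} ⊣_ε F̄_{e▷v}`
is an `ε`-fuzzy adjunction. -/
def IsFuzzyLap (D : LapSetup Q) (ε : Q) : Prop :=
  ∀ {e : D.E} {v : D.V} (h : D.incid e v) (a : D.Fv v) (b : D.Fe e),
    ε ≤ qhom (D.homE e (D.res h a) b) (D.homV v a (D.ext h b)) ∧
    ε ≤ qhom (D.homV v a (D.ext h b)) (D.homE e (D.res h a) b)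

/-- The Laplacian data is crisp: each restriction/extension pair is a genuine `Q`-adjunction. -/
def IsCrispLap (D : LapSetup Q) : Prop :=
  ∀ {e : D.E} {v : D.V} (h : D.incid e v) (a : D.Fv v) (b : D.Fe e),
    D.homE e (D.res h a) b = D.homV v a (D.ext h b)

/-- `x` is a `W`-fuzzy global section. -/
def IsGlobalSection (D : LapSetup Q) (W : D.V → D.V → Q) (x : Cochain D) : Prop :=
  ∀ {e : D.E} {v w : D.V} (hv : D.incid e v) (hw : D.incid e w), v ≠ w →
    W v w ≤ D.homE e (D.res hv (x v)) (D.res hw (x w))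

end Lap

section Residuation

variable {Q : Type v} [CompleteLattice Q] [CommMonoid Q] [IsQuantale Q]

theorem le_qhom_iff_s7 {p q r : Q} : r ≤ qhom p q ↔ p * r ≤ q :=
  Quantale.rightMulResiduation_le_iff_mul_le

end Residuation

/-- For an `ε`-fuzzy Lawvere Laplacian, a cochain satisfying
`W(v,w)·q ≤ hom_{Fe}(F_{v◁e} x_v, F_{w◁e} x_w)` on every edge is an `(ε·q)`-suffix point. -/
theorem section_to_suffix
    {Q : Type v} [CompleteLattice Q] [CommMonoid Q] [IsQuantale Q]
    (hsc : ∀ p q : Q, p * q ≤ p ⊓ q)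
    (D : LapSetup Q) (W : D.V → D.V → Q) (L : Cochain D → Cochain D)
    (hL : IsLawvereLaplacian D W L) (ε q : Q) (hε : IsFuzzyLap D ε)
    (x : Cochain D)
    (hx : ∀ {e : D.E} {v w : D.V} (hv : D.incid e v) (hw : D.incid e w), v ≠ w →
      W v w * q ≤ D.homE e (D.res hv (x v)) (D.res hw (x w))) :
    ε * q ≤ C0hom D x (L x) := by
  refine le_iInf fun v => ?_
  rw [hL x v (x v)]
  refine le_iInf fun p => le_qhom_iff_s7.2 ?_
  have hadj := le_qhom_iff_s7.1 (hε p.2.1 (x v) (D.res p.2.2.1 (x p.1.2))).1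
  have hW := hx p.2.1 p.2.2.1 p.2.2.2.symm
  calc W v p.1.2 * (ε * q) = ε * (W v p.1.2 * q) := mul_left_comm _ _ _
    _ ≤ ε * D.homE p.1.1 (D.res p.2.1 (x v)) (D.res p.2.2.1 (x p.1.2)) := by gcongr
    _ ≤ _ := by rwa [mul_comm]
end

section
/- Let F : ob(C) → ob(D) and G : ob(D) → ob(C) be crisp adjoint functions, i.e. hom_D(F x, y) = hom_C(x, G y) for all x ∈ C, y ∈ D. If F̃ : ob(C) → ob(D) satisfies F̃ ≈_q F (i.e. q ≤ hom_D(F x, F̃ x) ⊓ hom_D(F̃ x, F x) for all x), then F̃ ⊣_q G: for all x ∈ C and y ∈ D, q ≤ [hom_D(F̃ x, y), hom_C(x, G y)] and q ≤ [hom_C(x, G y), hom_D(F̃ x, y)]. Similarly, if G̃ satisfies G̃ ≈_q G then F ⊣_q G̃. -/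
/- `Q` is a commutative unital quantale: `[CommMonoid Q] [CompleteLattice Q] [IsQuantale Q]`
(Mathlib's `IsQuantale` says multiplication distributes over arbitrary suprema).
Semicartesianness (`∀ p q, p * q ≤ p ⊓ q`) is taken as an explicit hypothesis where needed. -/

universe u v w

/-- One half of the adjunction defining the internal hom. -/
theorem le_qhom_of_mul_le {Q : Type v} [CompleteLattice Q] [Mul Q] {p q r : Q}
    (h : p * r ≤ q) : r ≤ qhom p q :=
  le_sSup h

/-- Precomposition with an approximate morphism `x → x'`. -/
theorem IsQCategory.le_qhom_left {Q : Type v} [CompleteLattice Q] [CommMonoid Q] [IsQuantale Q]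
    {A : Type u} {hom : A → A → Q} (h : IsQCategory hom) {q : Q} {x x' : A}
    (hq : q ≤ hom x x') (y : A) : q ≤ qhom (hom x' y) (hom x y) := by
  apply le_qhom_of_mul_le
  rw [mul_comm]
  exact (mul_le_mul_left hq _).trans (h.comp x x' y)

/-- Postcomposition with an approximate morphism `y → y'`. -/
theorem IsQCategory.le_qhom_right {Q : Type v} [CompleteLattice Q] [CommMonoid Q] [IsQuantale Q]
    {A : Type u} {hom : A → A → Q} (h : IsQCategory hom) {q : Q} {y y' : A}
    (hq : q ≤ hom y y') (x : A) : q ≤ qhom (hom x y) (hom x y') :=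
  le_qhom_of_mul_le ((mul_le_mul_right hq _).trans (h.comp x y y'))

/-- If `F ⊣ G` are crisp adjoint functions and `F̃ ≈_q F` (resp. `G̃ ≈_q G`),
then `F̃ ⊣_q G` (resp. `F ⊣_q G̃`). -/
theorem fuzzy_adjoint_of_fuzzy_approximation
    {Q : Type v} [CompleteLattice Q] [CommMonoid Q] [IsQuantale Q]
    (hsc : ∀ p q : Q, p * q ≤ p ⊓ q)
    {A : Type u} {B : Type w} {homC : A → A → Q} {homD : B → B → Q}
    (hC : IsQCategory homC) (hD : IsQCategory homD)
    (F : A → B) (G : B → A)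
    (hadj : ∀ (x : A) (y : B), homD (F x) y = homC x (G y)) (q : Q) :
    (∀ F' : A → B, (∀ x, q ≤ homD (F x) (F' x) ⊓ homD (F' x) (F x)) →
      ∀ (x : A) (y : B),
        q ≤ qhom (homD (F' x) y) (homC x (G y)) ∧
        q ≤ qhom (homC x (G y)) (homD (F' x) y)) ∧
    (∀ G' : B → A, (∀ y, q ≤ homC (G y) (G' y) ⊓ homC (G' y) (G y)) →
      ∀ (x : A) (y : B),
        q ≤ qhom (homD (F x) y) (homC x (G' y)) ∧
        q ≤ qhom (homC x (G' y)) (homD (F x) y)) := by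
  refine ⟨fun F' hF x y => ?_, fun G' hG x y => ?_⟩
  · rw [← hadj]
    exact ⟨hD.le_qhom_left ((hF x).trans inf_le_left) y,
      hD.le_qhom_left ((hF x).trans inf_le_right) y⟩
  · rw [hadj]
    exact ⟨hC.le_qhom_right ((hG y).trans inf_le_left) x,
      hC.le_qhom_right ((hG y).trans inf_le_right) x⟩
end
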